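/- If A is an invertible n×n real matrix and B is an invertible p×p real matrix, then A⋉B is invertible and (A⋉B)⁻¹ = B⁻¹⋉A⁻¹. -/

import Mathlib

open Matrix Kronecker

/-- Semi-tensor product of real matrices:
`A ⋉ B := (A ⊗ I_{t/n})(B ⊗ I_{t/p})` where `t = lcm(n, p)`. -/
noncomputable def stp {m n p q : ℕ} (A : Matrix (Fin m) (Fin n) ℝ)
    (B : Matrix (Fin p) (Fin q) ℝ) :
    Matrix (Fin (m * (Nat.lcm n p / n))) (Fin (q * (Nat.lcm n p / p))) ℝ :=
  (Matrix.reindex finProdFinEquiv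
      (finProdFinEquiv.trans (finCongr (Nat.mul_div_cancel' (Nat.dvd_lcm_left n p))))
      (A ⊗ₖ (1 : Matrix (Fin (Nat.lcm n p / n)) (Fin (Nat.lcm n p / n)) ℝ))) *
  (Matrix.reindex
      (finProdFinEquiv.trans (finCongr (Nat.mul_div_cancel' (Nat.dvd_lcm_right n p))))
      finProdFinEquiv
      (B ⊗ₖ (1 : Matrix (Fin (Nat.lcm n p / p)) (Fin (Nat.lcm n p / p)) ℝ)))


/-- The semi-tensor product of two square matrices of sizes `n` and `p`, recast as a
square matrix of size `lcm n p`. -/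
noncomputable def stpSq {n p : ℕ} (A : Matrix (Fin n) (Fin n) ℝ)
    (B : Matrix (Fin p) (Fin p) ℝ) :
    Matrix (Fin (Nat.lcm n p)) (Fin (Nat.lcm n p)) ℝ :=
  Matrix.reindex
    (finCongr (Nat.mul_div_cancel' (Nat.dvd_lcm_left n p)))
    (finCongr (Nat.mul_div_cancel' (Nat.dvd_lcm_right n p)))
    (stp A B)

/-- The matrix `A ⊗ I_k`, viewed as a square matrix of size `t = n * k`. -/
noncomputable def kronOne {n k t : ℕ} (h : n * k = t) (A : Matrix (Fin n) (Fin n) ℝ) :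
    Matrix (Fin t) (Fin t) ℝ :=
  Matrix.reindex (finProdFinEquiv.trans (finCongr h)) (finProdFinEquiv.trans (finCongr h))
    (A ⊗ₖ (1 : Matrix (Fin k) (Fin k) ℝ))

lemma kronOne_one {n k t : ℕ} (h : n * k = t) : kronOne h 1 = 1 := by
  rw [kronOne, Matrix.one_kronecker_one, Matrix.reindex_apply, Matrix.submatrix_one_equiv]

lemma kronOne_mul {n k t : ℕ} (h : n * k = t) (A B : Matrix (Fin n) (Fin n) ℝ) :
    kronOne h (A * B) = kronOne h A * kronOne h B := by
  simp only [kronOne, Matrix.reindex_apply, Matrix.submatrix_mul_equiv,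
    ← Matrix.mul_kronecker_mul, mul_one]

lemma reindex_kronOne {n k k' t t' : ℕ} (h : n * k = t) (h' : n * k' = t') (hk : k = k')
    (ht : t = t') (A : Matrix (Fin n) (Fin n) ℝ) :
    Matrix.reindex (finCongr ht) (finCongr ht) (kronOne h A) = kronOne h' A := by
  subst hk ht
  rfl

lemma stpSq_eq_mul {n p : ℕ} (A : Matrix (Fin n) (Fin n) ℝ) (B : Matrix (Fin p) (Fin p) ℝ) :
    stpSq A B = kronOne (Nat.mul_div_cancel' (Nat.dvd_lcm_left n p)) A *
      kronOne (Nat.mul_div_cancel' (Nat.dvd_lcm_right n p)) B :=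
  rfl

lemma reindex_stpSq_swap {n p : ℕ} (A : Matrix (Fin n) (Fin n) ℝ)
    (B : Matrix (Fin p) (Fin p) ℝ) (h : Nat.lcm p n = Nat.lcm n p) :
    Matrix.reindex (finCongr h) (finCongr h) (stpSq B A) =
      kronOne (Nat.mul_div_cancel' (Nat.dvd_lcm_right n p)) B *
        kronOne (Nat.mul_div_cancel' (Nat.dvd_lcm_left n p)) A := by
  rw [← reindex_kronOne (Nat.mul_div_cancel' (Nat.dvd_lcm_left p n)) _ (by rw [h]) h B,
    ← reindex_kronOne (Nat.mul_div_cancel' (Nat.dvd_lcm_right p n)) _ (by rw [h]) h A,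
    stpSq_eq_mul]
  simp only [Matrix.reindex_apply, Matrix.submatrix_mul_equiv]

/-- If `A` and `B` are invertible square real matrices, then `A ⋉ B` is invertible and
`(A ⋉ B)⁻¹ = B⁻¹ ⋉ A⁻¹`. -/
theorem stp_inv {n p : ℕ} (A : Matrix (Fin n) (Fin n) ℝ) (B : Matrix (Fin p) (Fin p) ℝ)
    (hA : IsUnit A) (hB : IsUnit B) :
    IsUnit (stpSq A B) ∧
      (stpSq A B)⁻¹ =
        Matrix.reindex
          (finCongr (show Nat.lcm p n = Nat.lcm n p by rw [Nat.lcm_comm]))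
          (finCongr (show Nat.lcm p n = Nat.lcm n p by rw [Nat.lcm_comm]))
          (stpSq B⁻¹ A⁻¹) := by
  have key : stpSq A B * Matrix.reindex
      (finCongr (show Nat.lcm p n = Nat.lcm n p by rw [Nat.lcm_comm]))
      (finCongr (show Nat.lcm p n = Nat.lcm n p by rw [Nat.lcm_comm])) (stpSq B⁻¹ A⁻¹) = 1 := by
    rw [reindex_stpSq_swap, stpSq_eq_mul, mul_assoc, ← mul_assoc (kronOne _ B), ← kronOne_mul,
      Matrix.mul_nonsing_inv B ((Matrix.isUnit_iff_isUnit_det B).mp hB), kronOne_one, one_mul,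
      ← kronOne_mul, Matrix.mul_nonsing_inv A ((Matrix.isUnit_iff_isUnit_det A).mp hA),
      kronOne_one]
  exact ⟨IsUnit.of_mul_eq_one _ key, Matrix.inv_eq_right_inv key⟩
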